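/- In the monoid M_Bii, the elements Δ₁ := (a·b)^3 and Δ₂ := (c·b·a)^3 are fundamental elements with associated permutation the identity: one has (b·c·c)^3 = (c·b·a)^3, and for each i ∈ {1,2} and each generator d ∈ {a, b, c} there exists an element X of M_Bii such that Δᵢ = d·X and Δᵢ = X·d. -/

import Mathlib

/-- The three generators of the monoid `M_Bii`. -/
inductive BiiGen : Type
  | a | b | c

open FreeMonoid in
/-- The positive homogeneous relations `cbb = bba`, `bc = ab`, `ac = ca`. -/
def biiRel : FreeMonoid BiiGen → FreeMonoid BiiGen → Prop := fun x y =>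
  (x = of .c * of .b * of .b ∧ y = of .b * of .b * of .a) ∨
  (x = of .b * of .c ∧ y = of .a * of .b) ∨
  (x = of .a * of .c ∧ y = of .c * of .a)

/-- The monoid `M_Bii`: quotient of the free monoid on `{a,b,c}` by the congruence
generated by the relations `cbb = bba`, `bc = ab`, `ac = ca`. -/
abbrev MBii : Type := (conGen biiRel).Quotient

/-- The image of the generator `a` in `M_Bii`. -/
def MBii.a : MBii := (conGen biiRel).mk' (FreeMonoid.of BiiGen.a)
/-- The image of the generator `b` in `M_Bii`. -/
def MBii.b : MBii := (conGen biiRel).mk' (FreeMonoid.of BiiGen.b)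
/-- The image of the generator `c` in `M_Bii`. -/
def MBii.c : MBii := (conGen biiRel).mk' (FreeMonoid.of BiiGen.c)

namespace MBii

/-- The relation `cbb = bba` in `M_Bii`. -/
theorem c_mul_b_mul_b : c * b * b = b * b * a :=
  (Con.eq _).2 (ConGen.Rel.of _ _ (Or.inl ⟨rfl, rfl⟩))

/-- The relation `bc = ab` in `M_Bii`. -/
theorem b_mul_c : b * c = a * b :=
  (Con.eq _).2 (ConGen.Rel.of _ _ (Or.inr (Or.inl ⟨rfl, rfl⟩)))

/-- The relation `ac = ca` in `M_Bii`. -/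
theorem a_mul_c : a * c = c * a :=
  (Con.eq _).2 (ConGen.Rel.of _ _ (Or.inr (Or.inr ⟨rfl, rfl⟩)))

theorem semiconjBy_b_mul_c_pow_mul_b (k : ℕ) : SemiconjBy (b * c ^ k * b) a c := by
  have hb : SemiconjBy b c a := b_mul_c
  have hbb : SemiconjBy (b * b) a c := c_mul_b_mul_b.symm
  have hac : Commute a c := a_mul_c
  rw [(hb.pow_right k).eq, mul_assoc]
  exact (hac.pow_left k).semiconjBy.mul_left hbb

theorem commute_b_mul_c_pow_mul_b_mul_c_pow_mul_b (j k : ℕ) :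
    Commute (b * c ^ j * b * c ^ k * b) c := by
  have hb : SemiconjBy b c a := b_mul_c
  have hac : Commute a c := a_mul_c
  exact ((semiconjBy_b_mul_c_pow_mul_b j).mul_left (hac.symm.pow_left k).semiconjBy).mul_left hb

/-- Every cube `(b * c ^ (k + 1)) ^ 3` is fundamental, with the identity permutation. -/
theorem exists_eq_mul_and_eq_mul_of_mem (k : ℕ) {d : MBii} (hd : d ∈ ({a, b, c} : Set MBii)) :
    ∃ X : MBii, (b * c ^ (k + 1)) ^ 3 = d * X ∧ (b * c ^ (k + 1)) ^ 3 = X * d := by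
  have hb : SemiconjBy b c a := b_mul_c
  have hbpow : b * c ^ (k + 1) = a * a ^ k * b := by
    rw [← pow_succ']
    exact (hb.pow_right (k + 1)).eq
  have hac : Commute a c := a_mul_c
  have hcomm := commute_b_mul_c_pow_mul_b_mul_c_pow_mul_b (k + 1) (k + 1)
  have hcube : (b * c ^ (k + 1)) ^ 3 =
      b * c ^ (k + 1) * b * c ^ (k + 1) * b * c ^ (k + 1) := by
    simp only [pow_three, mul_assoc]
  rw [hcube]
  rcases hd with rfl | rfl | rfl
  · refine ⟨a ^ k * b * b * c ^ (k + 1) * b * c ^ (k + 1), ?_, ?_⟩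
    · rw [hbpow]
      simp only [mul_assoc]
    · calc b * c ^ (k + 1) * b * c ^ (k + 1) * b * c ^ (k + 1)
        _ = a * a ^ k * b * (b * c ^ (k + 1) * b) * c ^ (k + 1) := by
          rw [← hbpow]
          simp only [mul_assoc]
        _ = a ^ k * (a * b) * (b * c ^ (k + 1) * b) * c ^ (k + 1) := by
          rw [← pow_succ', pow_succ a, mul_assoc (a ^ k)]
        _ = a ^ k * b * (c * (b * c ^ (k + 1) * b)) * c ^ (k + 1) := by
          rw [← b_mul_c]
          simp only [mul_assoc]
        _ = a ^ k * b * (b * c ^ (k + 1) * b) * (a * c ^ (k + 1)) := by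
          rw [← (semiconjBy_b_mul_c_pow_mul_b (k + 1)).eq]
          simp only [mul_assoc]
        _ = a ^ k * b * b * c ^ (k + 1) * b * c ^ (k + 1) * a := by
          rw [(hac.pow_right (k + 1)).eq]
          simp only [mul_assoc]
  · refine ⟨c ^ (k + 1) * b * c ^ (k + 1) * b * c ^ (k + 1), ?_, ?_⟩
    · simp only [mul_assoc]
    · rw [(hcomm.pow_right (k + 1)).eq]
      simp only [mul_assoc]
  · refine ⟨b * c ^ (k + 1) * b * c ^ (k + 1) * b * c ^ k, ?_, ?_⟩
    · rw [← mul_assoc c, ← hcomm.eq, mul_assoc _ c, ← pow_succ']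
    · rw [mul_assoc _ (c ^ k), ← pow_succ]

theorem b_mul_c_mul_c_cubed : (b * c * c) ^ 3 = (c * b * a) ^ 3 := by
  have hcomm := commute_b_mul_c_pow_mul_b_mul_c_pow_mul_b 2 2
  have hsemi := semiconjBy_b_mul_c_pow_mul_b 2
  symm
  calc (c * b * a) ^ 3
    _ = c * b * (a * c) * b * (a * c) * b * a := by simp only [pow_three, mul_assoc]
    _ = c * b * c * (a * b) * c * (a * b) * a := by
      rw [a_mul_c]
      simp only [mul_assoc]
    _ = c * b * c * (b * c ^ 2 * b) * (c * a) := by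
      rw [← b_mul_c]
      simp only [pow_two, mul_assoc]
    _ = c * b * c * (b * c ^ 2 * b * a) * c := by
      rw [← a_mul_c]
      simp only [mul_assoc]
    _ = c * (b * c ^ 2 * b * c ^ 2 * b) * c := by
      rw [hsemi.eq]
      simp only [pow_two, mul_assoc]
    _ = (b * c * c) ^ 3 := by
      rw [← hcomm.eq]
      simp only [pow_two, pow_three, mul_assoc]

end MBii

open MBii in
/-- `(ab)³` and `(cba)³` are fundamental elements of `M_Bii` (with the identity
permutation of the generators), and `(bcc)³ = (cba)³`. -/
theorem MBii_fundamental_elements :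
    (b * c * c) ^ 3 = (c * b * a) ^ 3 ∧
    ∀ d ∈ ({a, b, c} : Set MBii),
      (∃ X : MBii, (a * b) ^ 3 = d * X ∧ (a * b) ^ 3 = X * d) ∧
      (∃ X : MBii, (c * b * a) ^ 3 = d * X ∧ (c * b * a) ^ 3 = X * d) := by
  refine ⟨b_mul_c_mul_c_cubed, fun d hd => ⟨?_, ?_⟩⟩
  · rw [← b_mul_c]
    simpa using exists_eq_mul_and_eq_mul_of_mem 0 hd
  · rw [← b_mul_c_mul_c_cubed, mul_assoc, ← pow_two]
    exact exists_eq_mul_and_eq_mul_of_mem 1 hd
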